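/- arXiv:2312.08316 — 3 statements merged into one kernel-verified Lean document; each statement's English description precedes it below -/
import Mathlib

section
/- The product * on monoid homomorphisms (S, +) → (K, ·) is associative: for all monoid homomorphisms x, y, z : (S, +) → (K, ·), (x*y)*z = x*(y*z). -/
open Finset

/-- The monoid `S = σ∨ ∩ M` of lattice points of the dual cone: elements `u ∈ M` with
`⟨p_j, u⟩ ≥ 0` for all `j`. -/
def dualS {M : Type*} [AddCommGroup M] {m : ℕ} (p : Fin (m + 1) → (M →+ ℤ)) :
    AddSubmonoid M where
  carrier := {u | ∀ j, 0 ≤ p j u}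
  zero_mem' := fun j => by simp
  add_mem' := fun {u v} hu hv j => by
    rw [map_add]; exact add_nonneg (hu j) (hv j)

/-- A point of the affine toric variety `X_σ`: a monoid homomorphism `(S, +) → (K, ·)`. -/
def IsPoint {K M : Type*} [Field K] [AddCommGroup M] {m : ℕ}
    (p : Fin (m + 1) → (M →+ ℤ)) (x : dualS p → K) : Prop :=
  x 0 = 1 ∧ ∀ u v : dualS p, x (u + v) = x u * x v

open Classical in
/-- Extension of a function on `S` to all of `M` by zero. -/
noncomputable def extend {K M : Type*} [Field K] [AddCommGroup M] {m : ℕ}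
    (p : Fin (m + 1) → (M →+ ℤ)) (x : dualS p → K) : M → K :=
  fun v => if h : v ∈ dualS p then x ⟨v, h⟩ else 0

/-- `e` is a Demazure root corresponding to the distinguished ray spanned by `p 0`:
`⟨p 0, e⟩ = −1` and `⟨p j, e⟩ ≥ 0` for all other `j`. -/
def IsDemazureRoot {M : Type*} [AddCommGroup M] {m : ℕ}
    (p : Fin (m + 1) → (M →+ ℤ)) (e : M) : Prop :=
  p 0 e = -1 ∧ ∀ j, j ≠ 0 → 0 ≤ p j e

/-- The product of two points:
`(x*y)(u) = Σ_{i+j=⟨p,u⟩} C(⟨p,u⟩,i) · x(u + i·e₂) · y(u + j·e₁)`. -/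
noncomputable def prodPt {K M : Type*} [Field K] [AddCommGroup M] {m : ℕ}
    (p : Fin (m + 1) → (M →+ ℤ)) (e₁ e₂ : M) (x y : dualS p → K) : dualS p → K :=
  fun u => ∑ i ∈ Finset.range ((p 0 (u : M)).toNat + 1),
    ((p 0 (u : M)).toNat.choose i : K) *
      extend p x ((u : M) + i • e₂) *
      extend p y ((u : M) + ((p 0 (u : M)).toNat - i) • e₁)

/-- The identity element `x_ρ` : `x_ρ(u) = 1` if `⟨p, u⟩ = 0` and `0` otherwise. -/
noncomputable def xrho {K M : Type*} [Field K] [AddCommGroup M] {m : ℕ}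
    (p : Fin (m + 1) → (M →+ ℤ)) : dualS p → K :=
  fun u => if p 0 (u : M) = 0 then 1 else 0

/-- Translating `u ∈ S` by `a` times a Demazure root stays in `S` as long as
`a ≤ ⟨p 0, u⟩`. -/
lemma add_nsmul_mem_dualS {M : Type*} [AddCommGroup M] {m : ℕ}
    {p : Fin (m + 1) → (M →+ ℤ)} {e u : M} (he : IsDemazureRoot p e) (hu : u ∈ dualS p)
    {a : ℕ} (ha : (a : ℤ) ≤ p 0 u) : u + a • e ∈ dualS p := by
  intro j
  rw [map_add, map_nsmul]
  by_cases hj : j = 0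
  · subst hj
    rw [he.1, nsmul_eq_mul]
    linarith
  · exact add_nonneg (hu j) (nsmul_nonneg (he.2 j hj) a)

lemma extend_prodPt {K M : Type*} [Field K] [AddCommGroup M] {m : ℕ}
    (p : Fin (m + 1) → (M →+ ℤ)) (e₁ e₂ : M) (x y : dualS p → K) {v : M}
    (hv : v ∈ dualS p) {n : ℕ} (hn : p 0 v = n) :
    extend p (prodPt p e₁ e₂ x y) v = ∑ i ∈ Finset.range (n + 1),
      (n.choose i : K) * extend p x (v + i • e₂) * extend p y (v + (n - i) • e₁) := by
  rw [extend, dif_pos hv, prodPt]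
  simp only [hn, Int.toNat_natCast]

/-- The product `*` on monoid homomorphisms `(S, +) → (K, ·)` is associative. -/
theorem stmt_3 {K M : Type*} [Field K] [IsAlgClosed K] [CharZero K]
    [AddCommGroup M] [Module.Free ℤ M] [Module.Finite ℤ M] {m : ℕ}
    (p : Fin (m + 1) → (M →+ ℤ)) (e₁ e₂ : M)
    (he₁ : IsDemazureRoot p e₁) (he₂ : IsDemazureRoot p e₂)
    (x y z : dualS p → K)
    (hx : IsPoint p x) (hy : IsPoint p y) (hz : IsPoint p z) :
    prodPt p e₁ e₂ (prodPt p e₁ e₂ x y) z = prodPt p e₁ e₂ x (prodPt p e₁ e₂ y z) := by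
  funext ⟨u, hu⟩
  obtain ⟨d, hd⟩ := Int.eq_ofNat_of_zero_le (hu 0)
  have hl : ∀ i ∈ Finset.range (d + 1), extend p (prodPt p e₁ e₂ x y) (u + i • e₂) =
      ∑ k ∈ Finset.range (d - i + 1), ((d - i).choose k : K) *
        extend p x (u + i • e₂ + k • e₂) * extend p y (u + i • e₂ + (d - i - k) • e₁) := by
    intro i hi
    have hi' : i ≤ d := Nat.lt_succ_iff.1 (Finset.mem_range.1 hi)
    refine extend_prodPt p e₁ e₂ x y (add_nsmul_mem_dualS he₂ hu (by omega)) ?_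
    rw [map_add, map_nsmul, he₂.1, hd, nsmul_eq_mul]
    push_cast [hi']
    ring
  have hr : ∀ i ∈ Finset.range (d + 1), extend p (prodPt p e₁ e₂ y z) (u + (d - i) • e₁) =
      ∑ k ∈ Finset.range (i + 1), (i.choose k : K) *
        extend p y (u + (d - i) • e₁ + k • e₂) *
          extend p z (u + (d - i) • e₁ + (i - k) • e₁) := by
    intro i hi
    have hi' : i ≤ d := Nat.lt_succ_iff.1 (Finset.mem_range.1 hi)
    refine extend_prodPt p e₁ e₂ y z (add_nsmul_mem_dualS he₁ hu (by omega)) ?_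
    rw [map_add, map_nsmul, he₁.1, hd, nsmul_eq_mul]
    push_cast [hi']
    ring
  rw [prodPt, prodPt]
  simp only [hd, Int.toNat_natCast]
  rw [Finset.sum_congr rfl fun i hi => by rw [hl i hi, Finset.mul_sum, Finset.sum_mul]]
  symm
  rw [Finset.sum_congr rfl fun i hi => by rw [hr i hi, Finset.mul_sum]]
  symm
  rw [Finset.sum_sigma', Finset.sum_sigma']
  refine Finset.sum_bij' (fun q _ => ⟨q.1 + q.2, q.1⟩) (fun q _ => ⟨q.2, q.1 - q.2⟩) ?_ ?_ ?_ ?_ ?_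
  · rintro ⟨i, k⟩ h
    simp only [Finset.mem_sigma, Finset.mem_range] at h ⊢
    omega
  · rintro ⟨a, k⟩ h
    simp only [Finset.mem_sigma, Finset.mem_range] at h ⊢
    omega
  · rintro ⟨i, k⟩ h
    simp
  · rintro ⟨a, k⟩ h
    simp only [Finset.mem_sigma, Finset.mem_range] at h
    simp only [Sigma.mk.injEq, heq_eq_eq, and_true]
    omega
  · rintro ⟨i, k⟩ h
    simp only [Finset.mem_sigma, Finset.mem_range] at h
    have hc : (d.choose (i + k) : K) * ((i + k).choose i : K) =
        (d.choose i : K) * ((d - i).choose k : K) := by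
      have := Nat.choose_mul (n := d) (k := i + k) (s := i) (by omega)
      rw [Nat.add_sub_cancel_left] at this
      exact_mod_cast this
    have hxx : u + i • e₂ + k • e₂ = u + (i + k) • e₂ := by rw [add_smul, add_assoc]
    have hyy : u + i • e₂ + (d - i - k) • e₁ = u + (d - (i + k)) • e₁ + i • e₂ := by
      rw [Nat.sub_sub, add_right_comm]
    have hzz : u + (d - (i + k)) • e₁ + (i + k - i) • e₁ = u + (d - i) • e₁ := by
      rw [add_assoc, ← add_smul]
      congr 2
      omega
    simp only [hxx, hyy, hzz]
    linear_combination (-extend p x (u + (i + k) • e₂) *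
      extend p y (u + (d - (i + k)) • e₁ + i • e₂) * extend p z (u + (d - i) • e₁)) * hc
end

section
/- Let S_ρ = {u ∈ M : ⟨p, u⟩ ≥ 0} and define the product of monoid homomorphisms (S_ρ, +) → (K, ·) by the same formula (x*y)(u) = Σ_{i+j=⟨p,u⟩} binom(⟨p,u⟩, i) · x(u + i·e₂) · y(u + j·e₁) (all arguments lie in S_ρ). For any monoid homomorphism y : (S_ρ, +) → (K, ·), the map z : S_ρ → K defined by z(u) = (−1)^{⟨p,u⟩} · y(−u − ⟨p,u⟩·(e₁ + e₂)) is a well-defined monoid homomorphism (the argument −u − ⟨p,u⟩·(e₁ + e₂) lies in S_ρ), and y * z = z * y = x_ρ, where x_ρ(u) = 1 if ⟨p, u⟩ = 0 and x_ρ(u) = 0 otherwise. In particular, every monoid homomorphism (S_ρ, +) → (K, ·) is invertible for *. -/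
open Finset

section HalfSpace

variable {K M : Type*} [Field K] [AddCommGroup M] {q : M →+ ℤ}

theorem mem_dualS_singleton {u : M} : u ∈ dualS (fun _ : Fin 1 => q) ↔ 0 ≤ q u :=
  ⟨fun h => h 0, fun h _ => h⟩

theorem extend_of_nonneg (x : dualS (fun _ : Fin 1 => q) → K) {u : M} (hu : 0 ≤ q u) :
    extend (fun _ : Fin 1 => q) x u = x ⟨u, mem_dualS_singleton.2 hu⟩ :=
  dif_pos _

theorem IsPoint.extend_zero {x : dualS (fun _ : Fin 1 => q) → K}
    (hx : IsPoint (fun _ : Fin 1 => q) x) : extend (fun _ : Fin 1 => q) x 0 = 1 := by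
  rw [extend_of_nonneg x (by simp)]
  exact hx.1

theorem IsPoint.extend_add {x : dualS (fun _ : Fin 1 => q) → K}
    (hx : IsPoint (fun _ : Fin 1 => q) x) {u v : M} (hu : 0 ≤ q u) (hv : 0 ≤ q v) :
    extend (fun _ : Fin 1 => q) x (u + v) =
      extend (fun _ : Fin 1 => q) x u * extend (fun _ : Fin 1 => q) x v := by
  rw [extend_of_nonneg x hu, extend_of_nonneg x hv,
    extend_of_nonneg x (by rw [map_add]; exact add_nonneg hu hv)]
  exact hx.2 ⟨u, _⟩ ⟨v, _⟩

/-- The inverse of a point `y` of the half-space monoid: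
`z(u) = (−1)^{⟨q,u⟩} · y(−u − ⟨q,u⟩·(e₁+e₂))`. -/
noncomputable def invPt (q : M →+ ℤ) (e₁ e₂ : M) (y : dualS (fun _ : Fin 1 => q) → K) :
    dualS (fun _ : Fin 1 => q) → K :=
  fun u => (-1 : K) ^ (q (u : M)).toNat *
    extend (fun _ : Fin 1 => q) y (-(u : M) - (q (u : M)) • (e₁ + e₂))

variable {e₁ e₂ : M}

theorem map_neg_sub_smul_add (h₁ : q e₁ = -1) (h₂ : q e₂ = -1) (u : M) :
    q (-u - q u • (e₁ + e₂)) = q u := by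
  rw [map_sub, map_neg, map_zsmul, map_add, h₁, h₂, smul_eq_mul]
  ring

theorem isPoint_invPt (h₁ : q e₁ = -1) (h₂ : q e₂ = -1) {y : dualS (fun _ : Fin 1 => q) → K}
    (hy : IsPoint (fun _ : Fin 1 => q) y) :
    IsPoint (fun _ : Fin 1 => q) (invPt q e₁ e₂ y) := by
  refine ⟨by simp [invPt, hy.extend_zero], fun u v => ?_⟩
  have hu := mem_dualS_singleton.1 u.2
  have hv := mem_dualS_singleton.1 v.2
  have hsum : -((u + v : dualS (fun _ : Fin 1 => q)) : M) -
      q ((u + v : dualS (fun _ : Fin 1 => q)) : M) • (e₁ + e₂) =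
      (-(u : M) - q (u : M) • (e₁ + e₂)) + (-(v : M) - q (v : M) • (e₁ + e₂)) := by
    rw [AddSubmonoid.coe_add, map_add]
    module
  simp only [invPt]
  rw [hsum, hy.extend_add (by rwa [map_neg_sub_smul_add h₁ h₂])
    (by rwa [map_neg_sub_smul_add h₁ h₂]), AddSubmonoid.coe_add, map_add,
    Int.toNat_add hu hv, pow_add]
  ring

/-- The alternating binomial sum behind `y * z = x_ρ`. -/
theorem sum_choose_mul_neg_one_pow (n : ℕ) :
    ∑ i ∈ range (n + 1), (n.choose i : K) * (-1) ^ i = if n = 0 then 1 else 0 := by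
  have h := add_pow (-1 : K) 1 n
  simp only [one_pow, mul_one, neg_add_cancel] at h
  rw [← zero_pow_eq, h]
  exact sum_congr rfl fun i _ => mul_comm _ _

theorem prodPt_invPt (h₁ : q e₁ = -1) (h₂ : q e₂ = -1) {y : dualS (fun _ : Fin 1 => q) → K}
    (hy : IsPoint (fun _ : Fin 1 => q) y) :
    prodPt (fun _ : Fin 1 => q) e₁ e₂ y (invPt q e₁ e₂ y) = xrho (fun _ : Fin 1 => q) := by
  funext ⟨u, hu⟩
  obtain ⟨d, hd⟩ := Int.eq_ofNat_of_zero_le (mem_dualS_singleton.1 hu)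
  have term : ∀ i ∈ range (d + 1), (d.choose i : K) *
      extend (fun _ : Fin 1 => q) y (u + i • e₂) *
      extend (fun _ : Fin 1 => q) (invPt q e₁ e₂ y) (u + (d - i) • e₁) =
      (d.choose i : K) * (-1) ^ i * extend (fun _ : Fin 1 => q) y (-(d • e₁)) := by
    intro i hi
    obtain ⟨j, rfl⟩ := Nat.exists_eq_add_of_le (mem_range_succ_iff.1 hi)
    rw [Nat.add_sub_cancel_left]
    have hl : q (u + i • e₂) = j := by simp [hd, h₂]
    have hr : q (u + j • e₁) = i := by simp [hd, h₁]
    have hz := map_neg_sub_smul_add h₁ h₂ (u + j • e₁)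
    have harg : -((i + j) • e₁) =
        (u + i • e₂) + (-(u + j • e₁) - q (u + j • e₁) • (e₁ + e₂)) := by
      rw [hr]; module
    rw [extend_of_nonneg (invPt q e₁ e₂ y) (by rw [hr]; positivity), harg,
      hy.extend_add (u := u + i • e₂) (by rw [hl]; positivity) (by rw [hz, hr]; positivity)]
    simp only [invPt, hr, Int.toNat_natCast]
    ring
  simp only [prodPt, xrho, hd, Int.toNat_natCast, Nat.cast_eq_zero]
  rw [sum_congr rfl term, ← sum_mul, sum_choose_mul_neg_one_pow]
  split_ifs with h
  · simp [h, hy.extend_zero]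
  · simp

theorem invPt_prodPt (h₁ : q e₁ = -1) (h₂ : q e₂ = -1) {y : dualS (fun _ : Fin 1 => q) → K}
    (hy : IsPoint (fun _ : Fin 1 => q) y) :
    prodPt (fun _ : Fin 1 => q) e₁ e₂ (invPt q e₁ e₂ y) y = xrho (fun _ : Fin 1 => q) := by
  rw [← prodPt_invPt h₂ h₁ hy]
  funext ⟨u, hu⟩
  simp only [prodPt]
  rw [← sum_range_reflect]
  refine sum_congr rfl fun i hi => ?_
  have hi := mem_range_succ_iff.1 hi
  have hinv : invPt q e₁ e₂ y = invPt q e₂ e₁ y := by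
    funext v
    rw [invPt, invPt, add_comm e₁]
  rw [Nat.add_sub_cancel, Nat.choose_symm hi, Nat.sub_sub_self hi, hinv]
  ring

end HalfSpace

/-- Let `S_ρ = {u ∈ M : ⟨p, u⟩ ≥ 0}` with the product given by the same
formula.  For any monoid homomorphism `y : (S_ρ, +) → (K, ·)`, the map
`z(u) = (−1)^{⟨p,u⟩} · y(−u − ⟨p,u⟩·(e₁+e₂))` is well defined (the argument lies in `S_ρ`), is
a monoid homomorphism, and `y * z = z * y = x_ρ`.  In particular every monoid homomorphism
`(S_ρ, +) → (K, ·)` is invertible for `*`. -/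
theorem stmt_5 {K M : Type*} [Field K] [IsAlgClosed K] [CharZero K]
    [AddCommGroup M] [Module.Free ℤ M] [Module.Finite ℤ M] {m : ℕ}
    (p : Fin (m + 1) → (M →+ ℤ)) (e₁ e₂ : M)
    (he₁ : IsDemazureRoot p e₁) (he₂ : IsDemazureRoot p e₂)
    (y : dualS (fun _ : Fin 1 => p 0) → K)
    (hy : IsPoint (fun _ : Fin 1 => p 0) y) :
    (∀ u : M, 0 ≤ p 0 u → -u - (p 0 u) • (e₁ + e₂) ∈ dualS (fun _ : Fin 1 => p 0)) ∧
    IsPoint (fun _ : Fin 1 => p 0)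
      (fun u => (-1 : K) ^ (p 0 (u : M)).toNat *
        extend (fun _ : Fin 1 => p 0) y (-(u : M) - (p 0 (u : M)) • (e₁ + e₂))) ∧
    prodPt (fun _ : Fin 1 => p 0) e₁ e₂ y
      (fun u => (-1 : K) ^ (p 0 (u : M)).toNat *
        extend (fun _ : Fin 1 => p 0) y (-(u : M) - (p 0 (u : M)) • (e₁ + e₂)))
      = xrho (fun _ : Fin 1 => p 0) ∧
    prodPt (fun _ : Fin 1 => p 0) e₁ e₂
      (fun u => (-1 : K) ^ (p 0 (u : M)).toNat *
        extend (fun _ : Fin 1 => p 0) y (-(u : M) - (p 0 (u : M)) • (e₁ + e₂))) y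
      = xrho (fun _ : Fin 1 => p 0) ∧
    (∀ x : dualS (fun _ : Fin 1 => p 0) → K, IsPoint (fun _ : Fin 1 => p 0) x →
      ∃ x' : dualS (fun _ : Fin 1 => p 0) → K, IsPoint (fun _ : Fin 1 => p 0) x' ∧
        prodPt (fun _ : Fin 1 => p 0) e₁ e₂ x x' = xrho (fun _ : Fin 1 => p 0) ∧
        prodPt (fun _ : Fin 1 => p 0) e₁ e₂ x' x = xrho (fun _ : Fin 1 => p 0)) := by
  exact ⟨fun u hu => mem_dualS_singleton.2 (by rwa [map_neg_sub_smul_add he₁.1 he₂.1]),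
    isPoint_invPt he₁.1 he₂.1 hy, prodPt_invPt he₁.1 he₂.1 hy, invPt_prodPt he₁.1 he₂.1 hy,
    fun x hx => ⟨invPt (p 0) e₁ e₂ x, isPoint_invPt he₁.1 he₂.1 hx,
      prodPt_invPt he₁.1 he₂.1 hx, invPt_prodPt he₁.1 he₂.1 hx⟩⟩
end

section
/- Assume that S generates M as a group (this holds when the cone σ generated by p₁, …, p_m is strongly convex). Then the product * on monoid homomorphisms (S, +) → (K, ·) is commutative (x*y = y*x for all x, y) if and only if e₁ = e₂. -/
open Finset

theorem prodPt_comm_of_eq {K M : Type*} [Field K] [AddCommGroup M] {m : ℕ}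
    (p : Fin (m + 1) → (M →+ ℤ)) (e : M) (x y : dualS p → K) :
    prodPt p e e x y = prodPt p e e y x := by
  funext u
  unfold prodPt
  rw [← Finset.sum_flip]
  refine Finset.sum_congr rfl fun i hi => ?_
  have hi' : i ≤ (p 0 (u : M)).toNat := Nat.lt_succ_iff.mp (Finset.mem_range.mp hi)
  rw [Nat.choose_symm hi', Nat.sub_sub_self hi']
  ring

/-- Adding a Demazure root to an element of `S` of positive height stays in `S`. -/
theorem IsDemazureRoot.add_mem {M : Type*} [AddCommGroup M] {m : ℕ}
    {p : Fin (m + 1) → (M →+ ℤ)} {e : M} (he : IsDemazureRoot p e) {u : M}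
    (hu : u ∈ dualS p) {n : ℕ} (hn : (n : ℤ) ≤ p 0 u) : u + n • e ∈ dualS p := by
  intro j
  rw [map_add, map_nsmul, nsmul_eq_mul]
  by_cases hj : j = 0
  · subst hj
    rw [he.1]
    linarith
  · exact add_nonneg (hu j) (mul_nonneg (Nat.cast_nonneg n) (he.2 j hj))

/-- If `S` generates `M` and a Demazure root exists, then `S` has an element of height one. -/
theorem exists_mem_dualS_eq_one {M : Type*} [AddCommGroup M] {m : ℕ}
    {p : Fin (m + 1) → (M →+ ℤ)} {e : M} (he : IsDemazureRoot p e)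
    (hgen : AddSubgroup.closure (dualS p : Set M) = ⊤) :
    ∃ u ∈ dualS p, p 0 u = 1 := by
  obtain ⟨u, hu, hpos⟩ : ∃ u ∈ dualS p, 0 < p 0 u := by
    by_contra! h
    have hker : AddSubgroup.closure (dualS p : Set M) ≤ (p 0).ker :=
      (AddSubgroup.closure_le _).mpr fun u hu => le_antisymm (h u hu) (hu 0)
    have hmem : e ∈ (p 0).ker := hker (hgen ▸ AddSubgroup.mem_top e)
    have h0 : p 0 e = 0 := hmem
    have h1 := he.1
    omega
  refine ⟨u + (p 0 u - 1).toNat • e, he.add_mem hu (by omega), ?_⟩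
  rw [map_add, map_nsmul, nsmul_eq_mul, he.1]
  omega

theorem isPoint_two_zpow {K M : Type*} [Field K] [CharZero K] [AddCommGroup M] {m : ℕ}
    (p : Fin (m + 1) → (M →+ ℤ)) (f : M →+ ℤ) :
    IsPoint p fun u : dualS p => (2 : K) ^ f u := by
  refine ⟨by simp, fun u v => ?_⟩
  simp only [AddSubmonoid.coe_add, map_add]
  exact zpow_add₀ two_ne_zero _ _

theorem extend_of_mem {K M : Type*} [Field K] [AddCommGroup M] {m : ℕ}
    {p : Fin (m + 1) → (M →+ ℤ)} (x : dualS p → K) {v : M} (hv : v ∈ dualS p) :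
    extend p x v = x ⟨v, hv⟩ :=
  dif_pos hv

/-- The product on elements of height one. -/
theorem prodPt_of_eq_one {K M : Type*} [Field K] [AddCommGroup M] {m : ℕ}
    {p : Fin (m + 1) → (M →+ ℤ)} (e₁ e₂ : M) (x y : dualS p → K) (u : dualS p)
    (hu : p 0 (u : M) = 1) :
    prodPt p e₁ e₂ x y u =
      x u * extend p y (u + e₁) + extend p x (u + e₂) * y u := by
  simp [prodPt, hu, Finset.sum_range_succ, extend_of_mem _ u.2]

theorem two_zpow_injective {K : Type*} [Field K] [CharZero K] :
    Function.Injective fun n : ℤ => (2 : K) ^ n := by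
  intro a b h
  have hrat : (2 : ℚ) ^ a = (2 : ℚ) ^ b := by
    have : (((2 : ℚ) ^ a : ℚ) : K) = (((2 : ℚ) ^ b : ℚ) : K) := by
      push_cast
      exact h
    exact_mod_cast this
  exact zpow_right_injective₀ (by norm_num) (by norm_num) hrat

/-- Assume `S` generates `M` as a group.  The product `*` on monoid
homomorphisms `(S, +) → (K, ·)` is commutative iff `e₁ = e₂`. -/
theorem stmt_7 {K M : Type*} [Field K] [IsAlgClosed K] [CharZero K]
    [AddCommGroup M] [Module.Free ℤ M] [Module.Finite ℤ M] {m : ℕ}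
    (p : Fin (m + 1) → (M →+ ℤ)) (e₁ e₂ : M)
    (he₁ : IsDemazureRoot p e₁) (he₂ : IsDemazureRoot p e₂)
    (hgen : AddSubgroup.closure (dualS p : Set M) = ⊤) :
    (∀ x y : dualS p → K, IsPoint p x → IsPoint p y →
        prodPt p e₁ e₂ x y = prodPt p e₁ e₂ y x) ↔ e₁ = e₂ := by
  refine ⟨fun hcomm => ?_, fun h x y => by subst h; exact fun _ _ => prodPt_comm_of_eq p e₁ x y⟩
  obtain ⟨u, hu, hu1⟩ := exists_mem_dualS_eq_one he₁ hgen
  have hu₁ : u + e₁ ∈ dualS p := by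
    simpa using he₁.add_mem hu (n := 1) (by simp [hu1])
  have hu₂ : u + e₂ ∈ dualS p := by
    simpa using he₂.add_mem hu (n := 1) (by simp [hu1])
  have key (f : M →+ ℤ) : f e₁ = f e₂ := by
    have h := congrFun (hcomm _ _ (isPoint_two_zpow p f) (isPoint_two_zpow p 0)) ⟨u, hu⟩
    rw [prodPt_of_eq_one _ _ _ _ _ hu1, prodPt_of_eq_one _ _ _ _ _ hu1] at h
    simp only [extend_of_mem _ hu₁, extend_of_mem _ hu₂, AddMonoidHom.zero_apply, zpow_zero,
      mul_one, one_mul] at h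
    have hpow : (2 : K) ^ f (u + e₁) = (2 : K) ^ f (u + e₂) := by linear_combination -h
    have := two_zpow_injective hpow
    simpa using this
  let b := Module.Free.chooseBasis ℤ M
  exact b.ext_elem fun i => key (b.coord i).toAddMonoidHom
end
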